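/- Let A be a finite set, d ∈ ℕ, and ξ : A → density matrices on ℂ^d. Define C₁(ξ) = max over probability distributions P on A, finite outcome sets B, and POVMs M on ℂ^d with outcomes in B, of the Shannon mutual information between input a ~ P and the outcome of measuring ξ(a) with M. For k ∈ ℕ define ξ^{(k)}(a₁,…,a_k) = ξ(a₁) ⊗ ⋯ ⊗ ξ(a_k) on (ℂ^d)^{⊗k}. Then for every k ∈ ℕ, the maximum over probability distributions P on A^k, finite outcome sets E₁,…,E_k, factorized POVMs M = M₁ ⊗ ⋯ ⊗ M_k (each M_i a POVM on ℂ^d with outcomes in E_i), and functions f from E₁×⋯×E_k to any finite set, of the Shannon mutual information between input aᵏ ~ P and f applied to the measurement outcome of ξ^{(k)}(aᵏ) under M, equals k · C₁(ξ). -/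

import Mathlib

open scoped BigOperators ComplexOrder

noncomputable section

namespace QKD

/-- A probability distribution on a finite type. -/
def IsProbDist {α : Type*} [Fintype α] (P : α → ℝ) : Prop :=
  (∀ a, 0 ≤ P a) ∧ ∑ a, P a = 1

/-- A classical channel (stochastic matrix) from `α` to `β`. -/
def IsChannel {α β : Type*} [Fintype α] [Fintype β] (V : α → β → ℝ) : Prop :=
  (∀ a b, 0 ≤ V a b) ∧ ∀ a, ∑ b, V a b = 1

/-- Shannon entropy, in bits. -/
def entropy {α : Type*} [Fintype α] (P : α → ℝ) : ℝ :=
  (∑ a, Real.negMulLog (P a)) / Real.log 2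

/-- Shannon mutual information (in bits) of a joint distribution on `α × β`. -/
def miJoint {α β : Type*} [Fintype α] [Fintype β] (J : α → β → ℝ) : ℝ :=
  entropy (fun a => ∑ b, J a b) + entropy (fun b => ∑ a, J a b)
    - entropy (fun p : α × β => J p.1 p.2)

/-- `I(P,V)`: mutual information between input distributed by `P` and output of channel `V`. -/
def chanMI {α β : Type*} [Fintype α] [Fintype β] (P : α → ℝ) (V : α → β → ℝ) : ℝ :=
  miJoint (fun a b => P a * V a b)

/-- The n-fold memoryless extension of a channel. -/
def nfold {α β : Type*} (n : ℕ) (V : α → β → ℝ) : (Fin n → α) → (Fin n → β) → ℝ :=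
  fun a b => ∏ i, V (a i) (b i)

/-- Joint distribution of Alice's key `K_A` (uniform on `K`) and the key obtained
by sending `K_A` through the random coder `F`, the channel `V`, and the decoder `f`. -/
def keyJoint {K A B : Type*} [Fintype K] [Fintype A] [Fintype B] [DecidableEq K]
    (F : K → A → ℝ) (V : A → B → ℝ) (f : B → K) : K → K → ℝ :=
  fun k k' => (Fintype.card K : ℝ)⁻¹ * ∑ a, F k a * ∑ b, if f b = k' then V a b else 0

/-- A density matrix: positive semidefinite with trace 1. -/
def IsDensity {ι : Type*} [Fintype ι] (ρ : Matrix ι ι ℂ) : Prop :=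
  ρ.PosSemidef ∧ ρ.trace = 1

/-- A POVM with outcomes in `B`: positive semidefinite operators summing to the identity. -/
def IsPOVM {ι B : Type*} [Fintype ι] [DecidableEq ι] [Fintype B]
    (M : B → Matrix ι ι ℂ) : Prop :=
  (∀ b, (M b).PosSemidef) ∧ ∑ b, M b = 1

/-- Von Neumann entropy (in bits) of a Hermitian matrix, via its eigenvalues. -/
def vnEntropy {ι : Type*} [Fintype ι] [DecidableEq ι] (ρ : Matrix ι ι ℂ) : ℝ :=
  if h : ρ.IsHermitian then (∑ i, Real.negMulLog (h.eigenvalues i)) / Real.log 2 else 0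

/-- The Holevo quantity χ(P, ξ) of the ensemble `{P(a), ξ(a)}`. -/
def holevo {A ι : Type*} [Fintype A] [Fintype ι] [DecidableEq ι]
    (P : A → ℝ) (ξ : A → Matrix ι ι ℂ) : ℝ :=
  vnEntropy (∑ a, (P a : ℂ) • ξ a) - ∑ a, P a * vnEntropy (ξ a)

/-- Probability of outcome `b` when measuring the state `ρ` with the POVM `M`. -/
def measProb {ι B : Type*} [Fintype ι] (M : B → Matrix ι ι ℂ)
    (ρ : Matrix ι ι ℂ) (b : B) : ℝ :=
  ((M b * ρ).trace).re

/-- Mutual information (in bits) between an input `a ~ P` and the outcome of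
measuring `ξ(a)` with the POVM `M`. -/
def measMI {A ι B : Type*} [Fintype A] [Fintype ι] [Fintype B]
    (P : A → ℝ) (ξ : A → Matrix ι ι ℂ) (M : B → Matrix ι ι ℂ) : ℝ :=
  miJoint (fun a b => P a * measProb M (ξ a) b)

/-- The tensor-power state `ξ(a₁) ⊗ ⋯ ⊗ ξ(a_n)`. -/
def tensPow {A ι : Type*} {n : ℕ} (ξ : A → Matrix ι ι ℂ) (a : Fin n → A) :
    Matrix (Fin n → ι) (Fin n → ι) ℂ :=
  Matrix.of fun v w => ∏ i, ξ (a i) (v i) (w i)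

/-- The set of Holevo quantities over all input distributions. -/
def holevoSet {A ι : Type*} [Fintype A] [Fintype ι] [DecidableEq ι]
    (ξ : A → Matrix ι ι ℂ) : Set ℝ :=
  { x | ∃ P : A → ℝ, IsProbDist P ∧ x = holevo P ξ }

/-- The set of accessible informations: mutual informations achievable with some
input distribution and some POVM (with an arbitrary finite outcome set). -/
def accInfoSet {A ι : Type*} [Fintype A] [Fintype ι] [DecidableEq ι]
    (ξ : A → Matrix ι ι ℂ) : Set ℝ :=
  { x | ∃ (P : A → ℝ) (m : ℕ) (M : Fin m → Matrix ι ι ℂ),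
      IsProbDist P ∧ IsPOVM M ∧ x = measMI P ξ M }


lemma trace_mul_psd_nonneg {ι : Type*} [Fintype ι] [DecidableEq ι] {M ρ : Matrix ι ι ℂ}
    (hM : M.PosSemidef) (hρ : ρ.PosSemidef) : 0 ≤ (M * ρ).trace := by
  open scoped MatrixOrder in
  obtain ⟨B, rfl⟩ := CStarAlgebra.nonneg_iff_eq_star_mul_self.mp hM.nonneg
  rw [Matrix.mul_assoc, Matrix.trace_mul_comm]
  exact (hρ.mul_mul_conjTranspose_same B).trace_nonneg

lemma measProb_channel {A ι B : Type*} [Fintype A] [Fintype ι] [DecidableEq ι] [Fintype B]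
    (ξ : A → Matrix ι ι ℂ) (hξ : ∀ a, IsDensity (ξ a)) (M : B → Matrix ι ι ℂ) (hM : IsPOVM M) :
    IsChannel (fun a b => measProb M (ξ a) b) := by
  refine ⟨fun a b => ?_, fun a => ?_⟩
  · exact (Complex.le_def.mp (trace_mul_psd_nonneg (hM.1 b) (hξ a).1)).1
  · simp only [measProb]
    rw [← Complex.re_sum, ← Matrix.trace_sum, ← Finset.sum_mul, hM.2, one_mul, (hξ a).2]
    simp

lemma trace_tens {A ι : Type*} [Fintype ι] [DecidableEq ι] {k : ℕ} {β : Fin k → Type*}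
    (ξ : A → Matrix ι ι ℂ) (hξ : ∀ a, IsDensity (ξ a))
    (M : (i : Fin k) → β i → Matrix ι ι ℂ) (hM : ∀ i b, (M i b).PosSemidef)
    (e : ∀ i, β i) (a : Fin k → A) :
    ((Matrix.of (fun v w : Fin k → ι => ∏ i, M i (e i) (v i) (w i)) * tensPow ξ a).trace).re
      = ∏ i, measProb (M i) (ξ (a i)) (e i) := by
  have h1 : (Matrix.of (fun v w : Fin k → ι => ∏ i, M i (e i) (v i) (w i)) * tensPow ξ a).trace
      = ∏ i, (M i (e i) * ξ (a i)).trace := by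
    simp only [Matrix.trace, Matrix.diag_apply, Matrix.mul_apply, tensPow, Matrix.of_apply]
    rw [Fintype.prod_sum]
    refine Finset.sum_congr rfl fun v _ => ?_
    rw [Fintype.prod_sum]
    refine Finset.sum_congr rfl fun w _ => ?_
    rw [Finset.prod_mul_distrib]
  have h2 : ∀ i, (M i (e i) * ξ (a i)).trace = ((measProb (M i) (ξ (a i)) (e i) : ℝ) : ℂ) := by
    intro i
    have := Complex.le_def.mp (trace_mul_psd_nonneg (hM i (e i)) (hξ (a i)).1)
    apply Complex.ext
    · simp [measProb]
    · simpa using this.2.symm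
  rw [h1, Finset.prod_congr rfl fun i _ => h2 i, ← Complex.ofReal_prod, Complex.ofReal_re]

/-- Mutual information in nats as output entropy minus conditional entropy. -/
def infoN {α β : Type*} [Fintype α] [Fintype β] (P : α → ℝ) (V : α → β → ℝ) : ℝ :=
  ∑ b, Real.negMulLog (∑ a, P a * V a b) - ∑ a, P a * ∑ b, Real.negMulLog (V a b)

lemma miJoint_eq {α β : Type*} [Fintype α] [Fintype β] (P : α → ℝ) (V : α → β → ℝ)
    (hV : IsChannel V) : miJoint (fun a b => P a * V a b) = infoN P V / Real.log 2 := by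
  have h : ∑ p : α × β, Real.negMulLog (P p.1 * V p.1 p.2)
      = ∑ a, Real.negMulLog (P a) + ∑ a, P a * ∑ b, Real.negMulLog (V a b) := by
    rw [Fintype.sum_prod_type, ← Finset.sum_add_distrib]
    refine Finset.sum_congr rfl fun a _ => ?_
    simp only [Real.negMulLog_mul]
    rw [Finset.sum_add_distrib, ← Finset.sum_mul, hV.2, one_mul, Finset.mul_sum]
  simp only [miJoint, entropy, infoN, h, ← Finset.mul_sum, hV.2, mul_one]
  ring

lemma gibbs_term {p q : ℝ} (hp : 0 ≤ p) (hq : 0 ≤ q) (hac : q = 0 → p = 0) :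
    Real.negMulLog p ≤ -(p * Real.log q) + (q - p) := by
  rcases hp.eq_or_lt with rfl | hp
  · simpa using hq
  have hq' : 0 < q := lt_of_le_of_ne hq fun h => hp.ne' (hac h.symm)
  have := Real.log_le_sub_one_of_pos (div_pos hq' hp)
  rw [Real.log_div hq'.ne' hp.ne'] at this
  have h2 := mul_le_mul_of_nonneg_left this hp.le
  have h3 : p * (q / p - 1) = q - p := by field_simp
  rw [h3] at h2
  simp only [Real.negMulLog]
  linarith

lemma gibbs {β : Type*} [Fintype β] (p q : β → ℝ) (hp : ∀ b, 0 ≤ p b) (hq : ∀ b, 0 ≤ q b)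
    (hac : ∀ b, q b = 0 → p b = 0) (hs : ∑ b, q b ≤ ∑ b, p b) :
    ∑ b, Real.negMulLog (p b) ≤ -∑ b, p b * Real.log (q b) := by
  have := Finset.sum_le_sum fun b (_ : b ∈ Finset.univ) => gibbs_term (hp b) (hq b) (hac b)
  rw [Finset.sum_add_distrib, Finset.sum_sub_distrib, Finset.sum_neg_distrib] at this
  linarith

lemma infoN_le {α β : Type*} [Fintype α] [Fintype β] (P : α → ℝ) (V : α → β → ℝ)
    (hP : IsProbDist P) (hV : IsChannel V) : infoN P V ≤ Fintype.card α := by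
  have h0 : ∀ a b, 0 ≤ P a * V a b := fun a b => mul_nonneg (hP.1 a) (hV.1 a b)
  have h1 : ∀ b, Real.negMulLog (∑ a, P a * V a b) ≤ ∑ a, Real.negMulLog (P a * V a b) := by
    intro b
    rw [Real.negMulLog, neg_mul, Finset.sum_mul, ← Finset.sum_neg_distrib]
    refine Finset.sum_le_sum fun a _ => ?_
    rcases (h0 a b).eq_or_lt with h | h
    · simp [← h]
    · have : Real.log (P a * V a b) ≤ Real.log (∑ a, P a * V a b) :=
        Real.log_le_log h (Finset.single_le_sum (f := fun a => P a * V a b)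
          (fun a _ => h0 a b) (Finset.mem_univ a))
      have := mul_le_mul_of_nonneg_left this h.le
      simp only [Real.negMulLog]
      linarith
  have h2 : ∑ b, ∑ a, Real.negMulLog (P a * V a b)
      = ∑ a, Real.negMulLog (P a) + ∑ a, P a * ∑ b, Real.negMulLog (V a b) := by
    rw [Finset.sum_comm, ← Finset.sum_add_distrib]
    refine Finset.sum_congr rfl fun a _ => ?_
    simp only [Real.negMulLog_mul]
    rw [Finset.sum_add_distrib, ← Finset.sum_mul, hV.2, one_mul, Finset.mul_sum]
  have h3 : ∑ a, Real.negMulLog (P a) ≤ Fintype.card α := by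
    have : ∀ a, Real.negMulLog (P a) ≤ 1 := fun a => by
      have := gibbs_term (hP.1 a) zero_le_one (by simp)
      simp only [Real.log_one, mul_zero] at this
      linarith [hP.1 a]
    calc _ ≤ ∑ a : α, (1 : ℝ) := Finset.sum_le_sum fun a _ => this a
      _ = _ := by simp
  have := Finset.sum_le_sum fun b (_ : b ∈ Finset.univ) => h1 b
  unfold infoN
  linarith

/-- Post-processing of a channel. -/
def post {α β γ : Type*} [Fintype β] [DecidableEq γ] (V : α → β → ℝ) (f : β → γ) : α → γ → ℝ :=
  fun a c => ∑ e, if f e = c then V a e else 0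

lemma post_sum {α β γ : Type*} [Fintype β] [Fintype γ] [DecidableEq γ] (V : α → β → ℝ)
    (f : β → γ) (a : α) (g : γ → ℝ) :
    ∑ c, post V f a c * g c = ∑ e, V a e * g (f e) := by
  simp only [post, Finset.sum_mul]
  rw [Finset.sum_comm]
  refine Finset.sum_congr rfl fun e _ => ?_
  simp [ite_mul]

lemma post_channel {α β γ : Type*} [Fintype α] [Fintype β] [Fintype γ] [DecidableEq γ]
    (V : α → β → ℝ) (hV : IsChannel V) (f : β → γ) : IsChannel (post V f) := by
  refine ⟨fun a c => Finset.sum_nonneg fun e _ => ?_, fun a => ?_⟩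
  · split_ifs
    exacts [hV.1 a e, le_rfl]
  · have := post_sum V f a (fun _ => 1)
    simpa [hV.2] using this

lemma data_processing {α β γ : Type*} [Fintype α] [Fintype β] [Fintype γ] [DecidableEq γ]
    (P : α → ℝ) (V : α → β → ℝ) (hP : IsProbDist P) (hV : IsChannel V) (f : β → γ) :
    infoN P (post V f) ≤ infoN P V := by
  have hW := post_channel V hV f
  set W := post V f with hWdef
  set Q : β → ℝ := fun e => ∑ a, P a * V a e with hQ
  set R : γ → ℝ := fun c => ∑ a, P a * W a c with hR
  have hQ0 : ∀ e, 0 ≤ Q e := fun e =>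
    Finset.sum_nonneg fun a _ => mul_nonneg (hP.1 a) (hV.1 a e)
  have hR0 : ∀ c, 0 ≤ R c := fun e =>
    Finset.sum_nonneg fun a _ => mul_nonneg (hP.1 a) (hW.1 a e)
  have hRQ : ∀ g : γ → ℝ, ∑ c, R c * g c = ∑ e, Q e * g (f e) := by
    intro g
    simp only [hR, hQ, Finset.sum_mul]
    rw [Finset.sum_comm, Finset.sum_comm (γ := β)]
    refine Finset.sum_congr rfl fun a _ => ?_
    simp only [mul_assoc]
    rw [← Finset.mul_sum, ← Finset.mul_sum, post_sum]
  have key : ∀ a, P a * ∑ e, Real.negMulLog (V a e) ≤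
      P a * (-∑ e, V a e * (Real.log (Q e) + Real.log (W a (f e)) - Real.log (R (f e)))) := by
    intro a
    rcases (hP.1 a).eq_or_lt with h | h
    · simp [← h]
    refine mul_le_mul_of_nonneg_left ?_ h.le
    have pos : ∀ e, V a e ≠ 0 → Q e ≠ 0 ∧ W a (f e) ≠ 0 ∧ R (f e) ≠ 0 := by
      intro e he
      have hv : 0 < V a e := lt_of_le_of_ne (hV.1 a e) he.symm
      have h1 : 0 < Q e := lt_of_lt_of_le (mul_pos h hv)
        (Finset.single_le_sum (f := fun a => P a * V a e)
          (fun a _ => mul_nonneg (hP.1 a) (hV.1 a e)) (Finset.mem_univ a))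
      have h2 : 0 < W a (f e) := by
        refine lt_of_lt_of_le hv ?_
        have := Finset.single_le_sum (f := fun e' => if f e' = f e then V a e' else 0)
          (fun e' _ => by
            show 0 ≤ (if f e' = f e then V a e' else 0)
            split_ifs
            exacts [hV.1 a e', le_rfl]) (Finset.mem_univ e)
        simpa [hWdef, post] using this
      have h3 : 0 < R (f e) := lt_of_lt_of_le (mul_pos h h2)
        (Finset.single_le_sum (f := fun a => P a * W a (f e))
          (fun a _ => mul_nonneg (hP.1 a) (hW.1 a (f e))) (Finset.mem_univ a))
      exact ⟨h1.ne', h2.ne', h3.ne'⟩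
    have := gibbs (V a) (fun e => Q e * (W a (f e) / R (f e))) (hV.1 a)
      (fun e => mul_nonneg (hQ0 e) (div_nonneg (hW.1 a _) (hR0 _)))
      (fun e he => by
        by_contra hne
        obtain ⟨h1, h2, h3⟩ := pos e hne
        exact mul_ne_zero h1 (div_ne_zero h2 h3) he)
      (by
        rw [← hRQ (fun c => W a c / R c), hV.2 a, ← hW.2 a]
        refine Finset.sum_le_sum fun c _ => ?_
        rcases eq_or_ne (R c) 0 with h0 | h0
        · simpa [h0] using hW.1 a c
        · rw [mul_div_cancel₀ _ h0])
    refine this.trans (le_of_eq ?_)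
    congr 1
    refine Finset.sum_congr rfl fun e _ => ?_
    rcases eq_or_ne (V a e) 0 with h0 | h0
    · simp [h0]
    obtain ⟨h1, h2, h3⟩ := pos e h0
    rw [Real.log_mul h1 (div_ne_zero h2 h3), Real.log_div h2 h3]
    ring
  have S := Finset.sum_le_sum fun a (_ : a ∈ Finset.univ) => key a
  have e1 : ∑ a, P a * (-∑ e, V a e * (Real.log (Q e) + Real.log (W a (f e)) - Real.log (R (f e))))
      = ∑ e, Real.negMulLog (Q e) + ∑ a, P a * ∑ c, Real.negMulLog (W a c)
        - ∑ c, Real.negMulLog (R c) := by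
    have t1 : ∑ e, Real.negMulLog (Q e) = ∑ a, P a * (-∑ e, V a e * Real.log (Q e)) := by
      simp only [Real.negMulLog, neg_mul, mul_neg, Finset.sum_neg_distrib]
      congr 1
      simp only [Finset.mul_sum]
      rw [Finset.sum_comm]
      refine Finset.sum_congr rfl fun e _ => ?_
      simp only [hQ, Finset.sum_mul, mul_assoc]
    have t2 : ∑ c, Real.negMulLog (R c) = ∑ a, P a * (-∑ e, V a e * Real.log (R (f e))) := by
      simp only [Real.negMulLog, neg_mul, mul_neg, Finset.sum_neg_distrib]
      congr 1
      rw [hRQ (fun c => Real.log (R c))]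
      simp only [Finset.mul_sum]
      rw [Finset.sum_comm]
      refine Finset.sum_congr rfl fun e _ => ?_
      simp only [hQ, Finset.sum_mul, mul_assoc]
    have t3 : ∀ a, ∑ c, Real.negMulLog (W a c) = -∑ e, V a e * Real.log (W a (f e)) := by
      intro a
      simp only [Real.negMulLog, neg_mul, Finset.sum_neg_distrib]
      rw [hWdef, post_sum V f a (fun c => Real.log (post V f a c))]
    simp only [t3]
    rw [t1, t2, ← Finset.sum_add_distrib,
      ← Finset.sum_sub_distrib]
    refine Finset.sum_congr rfl fun a _ => ?_
    simp only [mul_add, mul_sub, Finset.sum_add_distrib, Finset.sum_sub_distrib]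
    ring
  rw [e1] at S
  unfold infoN
  linarith

lemma prod_marg {k : ℕ} {β : Fin k → Type*} [∀ i, Fintype (β i)]
    (V : ∀ i, β i → ℝ) (hV : ∀ i, ∑ b, V i b = 1) (g : ∀ i, β i → ℝ) (i : Fin k) :
    ∑ e : ∀ i, β i, (∏ j, V j (e j)) * g i (e i) = ∑ b, V i b * g i b := by
  have h := Fintype.prod_sum (fun j b => V j b * (if j = i then g j b else 1))
  have h1 : ∀ e : ∀ i, β i, ∏ j, V j (e j) * (if j = i then g j (e j) else 1)
      = (∏ j, V j (e j)) * g i (e i) := by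
    intro e
    rw [Finset.prod_mul_distrib]
    simp
  simp only [h1] at h
  rw [← h, Fintype.prod_eq_single i]
  · simp
  · intro j hj
    simp [hj, hV]

lemma nml_prod {k : ℕ} (x : Fin k → ℝ) :
    Real.negMulLog (∏ i, x i) = ∑ i, (∏ j, x j) * (-Real.log (x i)) := by
  rw [← Finset.mul_sum, Finset.sum_neg_distrib, Real.negMulLog]
  by_cases h : ∏ i, x i = 0
  · simp [h]
  · rw [Real.log_prod (Finset.prod_ne_zero_iff.mp h)]
    ring

lemma entropy_prod {k : ℕ} {β : Fin k → Type*} [∀ i, Fintype (β i)]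
    (V : ∀ i, β i → ℝ) (hV : ∀ i, ∑ b, V i b = 1) :
    ∑ e : ∀ i, β i, Real.negMulLog (∏ i, V i (e i)) = ∑ i, ∑ b, Real.negMulLog (V i b) := by
  simp only [nml_prod]
  rw [Finset.sum_comm]
  refine Finset.sum_congr rfl fun i _ => ?_
  rw [prod_marg V hV (fun i b => -Real.log (V i b)) i]
  simp [Real.negMulLog]

/-- The `i`-th marginal of a distribution. -/
def marg {A : Type*} [Fintype A] {k : ℕ} (P : (Fin k → A) → ℝ) (i : Fin k) : A → ℝ :=
  open Classical in fun a => ∑ x, if x i = a then P x else 0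

lemma marg_sum {A : Type*} [Fintype A] {k : ℕ} (P : (Fin k → A) → ℝ) (i : Fin k) (g : A → ℝ) :
    ∑ a, marg P i a * g a = ∑ x, P x * g (x i) := by
  simp only [marg, Finset.sum_mul]
  rw [Finset.sum_comm]
  refine Finset.sum_congr rfl fun e _ => ?_
  classical
  simp only [ite_mul, zero_mul]
  rw [Finset.sum_eq_single (e i)]
  · simp
  · intro b _ hb
    simp [hb.symm]
  · simp

lemma marg_prob {A : Type*} [Fintype A] {k : ℕ} (P : (Fin k → A) → ℝ) (hP : IsProbDist P)
    (i : Fin k) : IsProbDist (marg P i) := by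
  refine ⟨fun a => Finset.sum_nonneg fun e _ => ?_, ?_⟩
  · split_ifs
    exacts [hP.1 e, le_rfl]
  · have := marg_sum P i (fun _ => 1)
    simpa [hP.2] using this

lemma prod_channel {A : Type*} [Fintype A] {k : ℕ} {β : Fin k → Type*} [∀ i, Fintype (β i)]
    (V : ∀ i, A → β i → ℝ) (hV : ∀ i, IsChannel (V i)) :
    IsChannel (fun (x : Fin k → A) (e : ∀ i, β i) => ∏ i, V i (x i) (e i)) := by
  refine ⟨fun x e => Finset.prod_nonneg fun i _ => (hV i).1 _ _, fun x => ?_⟩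
  rw [← Fintype.prod_sum (fun i b => V i (x i) b)]
  simp [(hV _).2]

lemma infoN_prod_le {A : Type*} [Fintype A] {k : ℕ} {β : Fin k → Type*} [∀ i, Fintype (β i)]
    (P : (Fin k → A) → ℝ) (hP : IsProbDist P)
    (V : ∀ i, A → β i → ℝ) (hV : ∀ i, IsChannel (V i)) :
    infoN P (fun (x : Fin k → A) (e : ∀ i, β i) => ∏ i, V i (x i) (e i))
      ≤ ∑ i, infoN (marg P i) (V i) := by
  have hpc := prod_channel V hV
  set R : ∀ i, β i → ℝ := fun i b => ∑ x, P x * V i (x i) b with hR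
  have hR0 : ∀ i b, 0 ≤ R i b := fun i b =>
    Finset.sum_nonneg fun x _ => mul_nonneg (hP.1 x) ((hV i).1 _ _)
  have hR1 : ∀ i, ∑ b, R i b = 1 := by
    intro i
    simp only [hR]
    rw [Finset.sum_comm]
    simp [← Finset.mul_sum, (hV i).2, hP.2]
  set Q : (∀ i, β i) → ℝ := fun e => ∑ x, P x * ∏ i, V i (x i) (e i) with hQ
  have hQ0 : ∀ e, 0 ≤ Q e := fun e =>
    Finset.sum_nonneg fun x _ => mul_nonneg (hP.1 x) (hpc.1 _ _)
  have hQ1 : ∑ e, Q e = 1 := by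
    simp only [hQ]
    rw [Finset.sum_comm]
    simp [← Finset.mul_sum, hpc.2, hP.2]
  have hac : ∀ e, ∏ i, R i (e i) = 0 → Q e = 0 := by
    intro e he
    obtain ⟨i, -, hi⟩ := Finset.prod_eq_zero_iff.mp he
    have := (Finset.sum_eq_zero_iff_of_nonneg
      (fun x _ => mul_nonneg (hP.1 x) ((hV i).1 _ _))).mp hi
    refine Finset.sum_eq_zero fun x _ => ?_
    rcases mul_eq_zero.mp (this x (Finset.mem_univ x)) with h | h
    · simp [h]
    · rw [Finset.prod_eq_zero (Finset.mem_univ i) h, mul_zero]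
  have G := gibbs Q (fun e => ∏ i, R i (e i)) hQ0
    (fun e => Finset.prod_nonneg fun i _ => hR0 i _) hac
    (by rw [← Fintype.prod_sum R, hQ1]; simp [hR1])
  have e1 : -∑ e, Q e * Real.log (∏ i, R i (e i)) = ∑ i, ∑ b, Real.negMulLog (R i b) := by
    have : ∀ e, Q e * Real.log (∏ i, R i (e i)) = ∑ i, Q e * Real.log (R i (e i)) := by
      intro e
      by_cases h : ∏ i, R i (e i) = 0
      · simp [hac e h]
      · rw [Real.log_prod (Finset.prod_ne_zero_iff.mp h), Finset.mul_sum]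
    simp only [this]
    rw [Finset.sum_comm, ← Finset.sum_neg_distrib]
    refine Finset.sum_congr rfl fun i _ => ?_
    simp only [Real.negMulLog, neg_mul, Finset.sum_neg_distrib]
    congr 1
    have l : ∑ e, Q e * Real.log (R i (e i)) = ∑ x, P x * ∑ b, V i (x i) b * Real.log (R i b) := by
      simp only [hQ, Finset.sum_mul]
      rw [Finset.sum_comm]
      refine Finset.sum_congr rfl fun x _ => ?_
      rw [← prod_marg (fun i b => V i (x i) b) (fun i => (hV i).2 _) (fun i b => Real.log (R i b)) i,
        Finset.mul_sum]
      simp only [mul_assoc]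
    rw [l]
    simp only [Finset.mul_sum]
    rw [Finset.sum_comm]
    refine Finset.sum_congr rfl fun b _ => ?_
    simp only [hR, Finset.sum_mul, mul_assoc]
  have e2 : ∑ i, infoN (marg P i) (V i) = ∑ i, ∑ b, Real.negMulLog (R i b)
      - ∑ x, P x * ∑ e : ∀ i, β i, Real.negMulLog (∏ i, V i (x i) (e i)) := by
    simp only [infoN, marg_sum P _ (fun a => V _ a _),
      marg_sum P _ (fun a => ∑ b, Real.negMulLog (V _ a b)), Finset.sum_sub_distrib]
    congr 1
    rw [Finset.sum_comm]
    refine Finset.sum_congr rfl fun x _ => ?_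
    rw [← Finset.mul_sum, entropy_prod (fun i b => V i (x i) b) (fun i => (hV i).2 _)]
  rw [e2]
  rw [e1] at G
  unfold infoN
  linarith

lemma infoN_pow {A B : Type*} [Fintype A] [Fintype B] (k : ℕ)
    (P : A → ℝ) (hP : IsProbDist P) (V : A → B → ℝ) (hV : IsChannel V) :
    infoN (fun x : Fin k → A => ∏ i, P (x i)) (fun x (e : Fin k → B) => ∏ i, V (x i) (e i))
      = k * infoN P V := by
  have h1 : ∀ e : Fin k → B, ∑ x : Fin k → A, (∏ i, P (x i)) * ∏ i, V (x i) (e i)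
      = ∏ i, ∑ a, P a * V a (e i) := by
    intro e
    rw [Fintype.prod_sum]
    simp only [Finset.prod_mul_distrib]
  have h2 : ∑ b, ∑ a, P a * V a b = 1 := by
    rw [Finset.sum_comm]
    simp [← Finset.mul_sum, hV.2, hP.2]
  unfold infoN
  simp only [h1]
  rw [entropy_prod (fun (_ : Fin k) b => ∑ a, P a * V a b) (fun _ => h2)]
  have h3 : ∀ x : Fin k → A, ∑ e : Fin k → B, Real.negMulLog (∏ i, V (x i) (e i))
      = ∑ i, ∑ b, Real.negMulLog (V (x i) b) := fun x =>
    entropy_prod (fun i b => V (x i) b) (fun i => hV.2 _)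
  simp only [h3, Finset.mul_sum (s := (Finset.univ : Finset (Fin k)))]
  rw [Finset.sum_comm (s := (Finset.univ : Finset (Fin k → A)))]
  have h4 : ∀ i : Fin k, ∑ x : Fin k → A, (∏ j, P (x j)) * ∑ b, Real.negMulLog (V (x i) b)
      = ∑ a, P a * ∑ b, Real.negMulLog (V a b) := fun i =>
    prod_marg (fun (_ : Fin k) => P) (fun _ => hP.2) (fun _ a => ∑ b, Real.negMulLog (V a b)) i
  simp only [h4, Finset.sum_const, Finset.card_univ, Fintype.card_fin, nsmul_eq_mul]
  ring

lemma infoN_post_equiv {α β γ : Type*} [Fintype α] [Fintype β] [Fintype γ] [DecidableEq γ]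
    (P : α → ℝ) (V : α → β → ℝ) (f : β ≃ γ) : infoN P (post V f) = infoN P V := by
  have h : ∀ a e, post V f a (f e) = V a e := by
    intro a e
    classical
    simp [post]
  unfold infoN
  rw [← Equiv.sum_comp f]
  simp only [← Equiv.sum_comp f (fun c => Real.negMulLog (post V f _ c)), h]


/-- **Additivity for individual (factorized) measurements with classical
post-processing.** For every `k ≥ 1`, the supremum over input distributions on
`A^k`, factorized POVMs `M₁ ⊗ ⋯ ⊗ M_k` (each `Mᵢ` with its own finite outcome
set) and arbitrary classical post-processing functions `f`, of the mutual
information between the input `aᵏ ~ P` and `f` of the measurement outcome on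
`ξ(a₁) ⊗ ⋯ ⊗ ξ(a_k)`, equals `k` times the single-copy accessible information
`C₁(ξ)`. -/
theorem factorized_measurements_additivity
    {A : Type*} [Fintype A] [Nonempty A] {d : ℕ}
    (ξ : A → Matrix (Fin d) (Fin d) ℂ) (hξ : ∀ a, IsDensity (ξ a))
    (k : ℕ) (hk : 0 < k) :
    sSup { x : ℝ | ∃ (P : (Fin k → A) → ℝ) (m : Fin k → ℕ)
        (M : (i : Fin k) → Fin (m i) → Matrix (Fin d) (Fin d) ℂ)
        (r : ℕ) (f : ((i : Fin k) → Fin (m i)) → Fin r),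
        IsProbDist P ∧ (∀ i, IsPOVM (M i)) ∧
        x = miJoint (fun (a : Fin k → A) (c : Fin r) =>
          P a * ∑ e : (i : Fin k) → Fin (m i), if f e = c then
            ((Matrix.of (fun v w : Fin k → Fin d => ∏ i, M i (e i) (v i) (w i)) *
              tensPow ξ a).trace).re
          else 0) }
      = k * sSup (accInfoSet ξ) := by
  have hlog : 0 < Real.log 2 := Real.log_pos one_lt_two
  have hform : ∀ (P : (Fin k → A) → ℝ) (m : Fin k → ℕ)
      (M : (i : Fin k) → Fin (m i) → Matrix (Fin d) (Fin d) ℂ)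
      (r : ℕ) (f : ((i : Fin k) → Fin (m i)) → Fin r), (∀ i, IsPOVM (M i)) →
      miJoint (fun (a : Fin k → A) (c : Fin r) =>
          P a * ∑ e : (i : Fin k) → Fin (m i), if f e = c then
            ((Matrix.of (fun v w : Fin k → Fin d => ∏ i, M i (e i) (v i) (w i)) *
              tensPow ξ a).trace).re
          else 0) =
      infoN P (post (fun (x : Fin k → A) (e : ∀ i, Fin (m i)) =>
        ∏ i, measProb (M i) (ξ (x i)) (e i)) f) / Real.log 2 := by
    intro P m M r f hM
    rw [← miJoint_eq _ _ (post_channel _ (prod_channel (fun i a b => measProb (M i) (ξ a) b)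
      (fun i => measProb_channel ξ hξ (M i) (hM i))) f)]
    simp only [trace_tens ξ hξ M (fun i => (hM i).1), post]
  have hbdd : BddAbove (accInfoSet ξ) := by
    refine ⟨Fintype.card A / Real.log 2, ?_⟩
    rintro x ⟨P, m, M, hP, hM, rfl⟩
    have hc := measProb_channel ξ hξ M hM
    rw [measMI, miJoint_eq _ _ hc]
    exact div_le_div_of_nonneg_right (infoN_le P _ hP hc) hlog.le
  have hub : ∀ x ∈ { x : ℝ | ∃ (P : (Fin k → A) → ℝ) (m : Fin k → ℕ)
        (M : (i : Fin k) → Fin (m i) → Matrix (Fin d) (Fin d) ℂ)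
        (r : ℕ) (f : ((i : Fin k) → Fin (m i)) → Fin r),
        IsProbDist P ∧ (∀ i, IsPOVM (M i)) ∧
        x = miJoint (fun (a : Fin k → A) (c : Fin r) =>
          P a * ∑ e : (i : Fin k) → Fin (m i), if f e = c then
            ((Matrix.of (fun v w : Fin k → Fin d => ∏ i, M i (e i) (v i) (w i)) *
              tensPow ξ a).trace).re
          else 0) }, x ≤ k * sSup (accInfoSet ξ) := by
    rintro x ⟨P, m, M, r, f, hP, hM, rfl⟩
    rw [hform P m M r f hM]
    have hV := fun i => measProb_channel ξ hξ (M i) (hM i)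
    have h1 := data_processing P _ hP (prod_channel _ hV) f
    have h2 := infoN_prod_le P hP _ hV
    have h3 : ∀ i, infoN (marg P i) (fun a b => measProb (M i) (ξ a) b) / Real.log 2
        ≤ sSup (accInfoSet ξ) := by
      intro i
      refine le_csSup hbdd ⟨marg P i, m i, M i, marg_prob P hP i, hM i, ?_⟩
      rw [measMI, miJoint_eq _ _ (hV i)]
    calc _ ≤ (∑ i, infoN (marg P i) (fun a b => measProb (M i) (ξ a) b)) / Real.log 2 :=
          div_le_div_of_nonneg_right (h1.trans h2) hlog.le
      _ = ∑ i, infoN (marg P i) (fun a b => measProb (M i) (ξ a) b) / Real.log 2 :=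
          Finset.sum_div _ _ _
      _ ≤ ∑ _i : Fin k, sSup (accInfoSet ξ) := Finset.sum_le_sum fun i _ => h3 i
      _ = _ := by simp
  have hlb : ∀ x ∈ accInfoSet ξ, (k : ℝ) * x ∈ { x : ℝ | ∃ (P : (Fin k → A) → ℝ) (m : Fin k → ℕ)
        (M : (i : Fin k) → Fin (m i) → Matrix (Fin d) (Fin d) ℂ)
        (r : ℕ) (f : ((i : Fin k) → Fin (m i)) → Fin r),
        IsProbDist P ∧ (∀ i, IsPOVM (M i)) ∧
        x = miJoint (fun (a : Fin k → A) (c : Fin r) =>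
          P a * ∑ e : (i : Fin k) → Fin (m i), if f e = c then
            ((Matrix.of (fun v w : Fin k → Fin d => ∏ i, M i (e i) (v i) (w i)) *
              tensPow ξ a).trace).re
          else 0) } := by
    rintro x ⟨P, m, M, hP, hM, rfl⟩
    have hV := measProb_channel ξ hξ M hM
    refine ⟨fun x => ∏ i, P (x i), fun _ => m, fun _ => M, _,
      Fintype.equivFin (Fin k → Fin m), ⟨fun x => Finset.prod_nonneg fun i _ => hP.1 _, ?_⟩,
      fun _ => hM, ?_⟩
    · rw [← Fintype.prod_sum (fun (_ : Fin k) a => P a)]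
      simp [hP.2]
    · rw [hform _ (fun _ => m) (fun _ => M) _ _ (fun _ => hM), infoN_post_equiv,
        infoN_pow k P hP _ hV, measMI, miJoint_eq _ _ hV]
      ring
  have hne : (accInfoSet ξ).Nonempty := by
    classical
    obtain ⟨a0⟩ := ‹Nonempty A›
    refine ⟨_, fun a => if a = a0 then 1 else 0, 1, fun _ => 1, ⟨fun a => ?_, by simp⟩,
      ⟨fun _ => Matrix.PosSemidef.one, by simp⟩, rfl⟩
    show (0 : ℝ) ≤ if a = a0 then 1 else 0
    split_ifs <;> norm_num
  have hk' : (0 : ℝ) < k := by exact_mod_cast hk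
  apply le_antisymm
  · obtain ⟨y, hy⟩ := hne
    exact csSup_le ⟨_, hlb y hy⟩ hub
  · rw [mul_comm, ← le_div_iff₀ hk']
    refine csSup_le hne fun x hx => ?_
    rw [le_div_iff₀ hk', mul_comm]
    exact le_csSup ⟨_, hub⟩ (hlb x hx)

end QKD
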